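/- arXiv:2104.05024 — 2 statements merged into one kernel-verified Lean document; each statement's English description precedes it below -/
import Mathlib

section
/- Let σ > 0 and let u⁺, u⁻ : ℝ → ℝ be four times continuously differentiable. Fix real numbers z, h with h > 0, and a grid node x_k with x_k ≤ z < x_k + h. Assume |(u⁺)'''| ≤ M₃, |(u⁻)'''| ≤ M₃, |(u⁺)⁗| ≤ M₄, and |(u⁻)⁗| ≤ M₄ on the interval [x_k − h, x_k + h]. Write [u^{(j)}] := (u⁺)^{(j)}(z) − (u⁻)^{(j)}(z) for the jumps at z, and δ := x_k + h − z. Define the uncorrected local truncation error E := σ·(u⁻(x_k + h) + u⁺(x_k − h) − 2u⁺(x_k))/h² − σ·(u⁺)''(x_k) and the correction C := (σ/h²)·([u] + [u']·δ + (1/2)[u'']·δ²). Then |E + C| ≤ (σ M₃ / 3)·h + (σ M₄ / 6)·h². In particular, the corrected finite difference equation at the irregular node x_k has first-order local truncation error. -/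
theorem aux_within (f : ℝ → ℝ) (hf : ContDiff ℝ 4 f) (a b t : ℝ) (hab : a ≠ b) (ht : t ∈ Set.uIcc a b)
    (n : ℕ) (hn : n ≤ 4) :
    iteratedDerivWithin n f (Set.uIcc a b) t = iteratedDeriv n f t := by
  apply iteratedDerivWithin_eq_iteratedDeriv
  · exact uniqueDiffOn_Icc (by grind)
  · exact (hf.of_le (by exact_mod_cast hn)).contDiffAt
  · exact ht

theorem aux_taylor (f : ℝ → ℝ) (hf : ContDiff ℝ 4 f) (a b : ℝ) (hab : a ≠ b)
    (n : ℕ) (hn : n + 1 ≤ 4) :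
    ∃ t ∈ Set.uIcc a b, f b - ∑ k ∈ Finset.range (n + 1),
      ((k.factorial : ℝ)⁻¹ * (b - a) ^ k) * iteratedDeriv k f a
      = iteratedDeriv (n + 1) f t * (b - a) ^ (n + 1) / (n + 1).factorial := by
  have hud : UniqueDiffOn ℝ (Set.uIcc a b) := uniqueDiffOn_Icc (by grind)
  have hd : DifferentiableOn ℝ (iteratedDerivWithin n f (Set.uIcc a b)) (Set.uIcc a b) :=
    (hf.contDiffOn).differentiableOn_iteratedDerivWithin (by exact_mod_cast hn) hud
  obtain ⟨t, ht, h⟩ := taylor_mean_remainder_lagrange (n := n) hab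
    ((hf.of_le (by exact_mod_cast (by omega : n ≤ 4))).contDiffOn)
    (hd.mono Set.uIoo_subset_uIcc_self)
  have ht' := Set.uIoo_subset_uIcc_self ht
  refine ⟨t, ht', ?_⟩
  rw [aux_within f hf a b t hab ht' _ hn, taylor_within_apply] at h
  rw [← h]
  congr 1
  apply Finset.sum_congr rfl
  intro k hk
  rw [aux_within f hf a b a hab Set.left_mem_uIcc k (by grind), smul_eq_mul]

/-- Corrected local truncation error at an irregular grid node is first order:
with jump corrections up to second order added, the corrected truncation error
`E + C` is bounded by `(σ M₃ / 3) h + (σ M₄ / 6) h²`. -/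
theorem corrected_truncation_error_first_order
    (σ : ℝ) (hσ : 0 < σ) (uplus uminus : ℝ → ℝ)
    (huplus : ContDiff ℝ 4 uplus) (huminus : ContDiff ℝ 4 uminus)
    (z h xk : ℝ) (hh : 0 < h) (hz : xk ≤ z) (hz' : z < xk + h)
    (M₃ M₄ : ℝ)
    (hM3p : ∀ t ∈ Set.Icc (xk - h) (xk + h), |iteratedDeriv 3 uplus t| ≤ M₃)
    (hM3m : ∀ t ∈ Set.Icc (xk - h) (xk + h), |iteratedDeriv 3 uminus t| ≤ M₃)
    (hM4p : ∀ t ∈ Set.Icc (xk - h) (xk + h), |iteratedDeriv 4 uplus t| ≤ M₄)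
    (hM4m : ∀ t ∈ Set.Icc (xk - h) (xk + h), |iteratedDeriv 4 uminus t| ≤ M₄)
    (δ E C : ℝ) (hδ : δ = xk + h - z)
    (hE : E = σ * (uminus (xk + h) + uplus (xk - h) - 2 * uplus xk) / h ^ 2
            - σ * iteratedDeriv 2 uplus xk)
    (hC : C = σ / h ^ 2 *
            ((uplus z - uminus z)
              + (deriv uplus z - deriv uminus z) * δ
              + (1 / 2) * (iteratedDeriv 2 uplus z - iteratedDeriv 2 uminus z) * δ ^ 2)) :
    |E + C| ≤ σ * M₃ / 3 * h + σ * M₄ / 6 * h ^ 2 := by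
  have hδ0 : 0 < δ := by linarith
  have hδh : δ ≤ h := by linarith
  obtain ⟨p, hp, e1⟩ := aux_taylor uplus huplus xk (xk + h) (by linarith) 3 (by norm_num)
  obtain ⟨q, hq, e2⟩ := aux_taylor uplus huplus xk (xk - h) (by linarith) 3 (by norm_num)
  obtain ⟨r, hr, e3⟩ := aux_taylor uplus huplus z (xk + h) (by linarith) 2 (by norm_num)
  obtain ⟨s, hs, e4⟩ := aux_taylor uminus huminus z (xk + h) (by linarith) 2 (by norm_num)
  rw [Set.uIcc_of_le (by linarith)] at hp hr hs
  rw [Set.uIcc_of_ge (by linarith)] at hq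
  have b1 := abs_le.1 (hM4p p ⟨by linarith [hp.1], hp.2⟩)
  have b2 := abs_le.1 (hM4p q ⟨hq.1, by linarith [hq.2]⟩)
  have b3 := abs_le.1 (hM3p r ⟨by linarith [hr.1], hr.2⟩)
  have b4 := abs_le.1 (hM3m s ⟨by linarith [hs.1], hs.2⟩)
  rw [← hδ] at e3 e4
  simp only [Finset.sum_range_succ, Finset.sum_range_zero, Nat.factorial, iteratedDeriv_zero,
    iteratedDeriv_one] at e1 e2 e3 e4
  norm_num at e1 e2 e3 e4
  generalize iteratedDeriv 4 uplus p = P at *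
  generalize iteratedDeriv 4 uplus q = Q at *
  generalize iteratedDeriv 3 uplus r = R at *
  generalize iteratedDeriv 3 uminus s = S at *
  have key : E + C = σ * ((P + Q) / 24 * h ^ 2 + (S - R) / 6 * (δ ^ 3 / h ^ 2)) := by
    rw [hE, hC]
    field_simp
    linear_combination 288 * e1 + 288 * e2 - 288 * e3 + 288 * e4
  have hM3 : 0 ≤ M₃ := by linarith
  have hM4 : 0 ≤ M₄ := by linarith
  have hd3 : δ ^ 3 / h ^ 2 ≤ h := by
    rw [div_le_iff₀ (by positivity)]
    calc δ ^ 3 ≤ h ^ 3 := by gcongr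
      _ = h * h ^ 2 := by ring
  have hd0 : 0 ≤ δ ^ 3 / h ^ 2 := by positivity
  have t1 : |(P + Q) / 24 * h ^ 2| ≤ M₄ / 6 * h ^ 2 := by
    rw [abs_mul, abs_of_nonneg (sq_nonneg h)]
    gcongr
    rw [abs_le]; constructor <;> linarith
  have t2 : |(S - R) / 6 * (δ ^ 3 / h ^ 2)| ≤ M₃ / 3 * h := by
    rw [abs_mul, abs_of_nonneg hd0]
    gcongr
    rw [abs_le]; constructor <;> linarith
  rw [key, abs_mul, abs_of_pos hσ]
  calc _ ≤ σ * (M₄ / 6 * h ^ 2 + M₃ / 3 * h) := by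
        gcongr
        exact (abs_add_le _ _).trans (add_le_add t1 t2)
    _ = _ := by ring
end

section
/- Let the ten points (ξ_j, η_j, ζ_j), j = 0,…,9, be (0,0,0), (1,0,0), (0,1,0), (0,0,1), (2,0,0), (0,2,0), (0,0,2), (1,1,0), (1,0,1), (0,1,1) in ℝ³. Then the 10×10 real matrix whose j-th row is (1, ξ_j, η_j, ζ_j, (1/2)ξ_j², (1/2)η_j², (1/2)ζ_j², ξ_jη_j, ξ_jζ_j, η_jζ_j) is invertible. Consequently, for any prescribed values V_0,…,V_9 ∈ ℝ there exists a unique tuple (V, V_x, V_y, V_z, V_xx, V_yy, V_zz, V_xy, V_xz, V_yz) ∈ ℝ^{10} solving the ten truncated second-order Taylor interpolation equations at these points. -/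
/-- The ten stencil points of the three-dimensional quadratic interpolation. -/
def stencil3D : Fin 10 → ℝ × ℝ × ℝ :=
  ![(0, 0, 0), (1, 0, 0), (0, 1, 0), (0, 0, 1), (2, 0, 0),
    (0, 2, 0), (0, 0, 2), (1, 1, 0), (1, 0, 1), (0, 1, 1)]

/-- The 10×10 collocation matrix whose `j`-th row is
`(1, ξ_j, η_j, ζ_j, ξ_j²/2, η_j²/2, ζ_j²/2, ξ_jη_j, ξ_jζ_j, η_jζ_j)`. -/
noncomputable def collocation3D : Matrix (Fin 10) (Fin 10) ℝ :=
  fun j => ![1, (stencil3D j).1, (stencil3D j).2.1, (stencil3D j).2.2,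
    (1 / 2) * (stencil3D j).1 ^ 2, (1 / 2) * (stencil3D j).2.1 ^ 2,
    (1 / 2) * (stencil3D j).2.2 ^ 2,
    (stencil3D j).1 * (stencil3D j).2.1,
    (stencil3D j).1 * (stencil3D j).2.2,
    (stencil3D j).2.1 * (stencil3D j).2.2]

/-- The 10×10 collocation matrix of the ten-point quadratic interpolation stencil
is invertible; consequently, for any data `V_j` there is a unique tuple
`(V, V_x, V_y, V_z, V_xx, V_yy, V_zz, V_xy, V_xz, V_yz)` solving the truncated
second-order Taylor interpolation equations. -/
theorem collocation3D_invertible :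
    IsUnit collocation3D.det ∧
    ∀ V : Fin 10 → ℝ, ∃! c : Fin 10 → ℝ, ∀ j : Fin 10,
      c 0 + c 1 * (stencil3D j).1 + c 2 * (stencil3D j).2.1
        + c 3 * (stencil3D j).2.2
        + (1 / 2) * c 4 * (stencil3D j).1 ^ 2
        + (1 / 2) * c 5 * (stencil3D j).2.1 ^ 2
        + (1 / 2) * c 6 * (stencil3D j).2.2 ^ 2
        + c 7 * (stencil3D j).1 * (stencil3D j).2.1
        + c 8 * (stencil3D j).1 * (stencil3D j).2.2
        + c 9 * (stencil3D j).2.1 * (stencil3D j).2.2 = V j := by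
  have key : ∀ (c : Fin 10 → ℝ) (j : Fin 10), collocation3D.mulVec c j =
      c 0 + c 1 * (stencil3D j).1 + c 2 * (stencil3D j).2.1
        + c 3 * (stencil3D j).2.2
        + (1 / 2) * c 4 * (stencil3D j).1 ^ 2
        + (1 / 2) * c 5 * (stencil3D j).2.1 ^ 2
        + (1 / 2) * c 6 * (stencil3D j).2.2 ^ 2
        + c 7 * (stencil3D j).1 * (stencil3D j).2.1
        + c 8 * (stencil3D j).1 * (stencil3D j).2.2
        + c 9 * (stencil3D j).2.1 * (stencil3D j).2.2 := by
    intro c j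
    simp only [Matrix.mulVec, dotProduct, collocation3D, Fin.sum_univ_succ]
    simp
    ring
  have inj : Function.Injective collocation3D.mulVec := by
    intro c d h
    have e : ∀ j, collocation3D.mulVec c j = collocation3D.mulVec d j := fun j => congrFun h j
    simp only [key] at e
    have e0 := e 0
    have e1 := e 1
    have e2 := e 2
    have e3 := e 3
    have e4 := e 4
    have e5 := e 5
    have e6 := e 6
    have e7 := e 7
    have e8 := e 8
    have e9 := e 9
    clear e h
    simp [stencil3D] at e0 e1 e2 e3 e4 e5 e6 e7 e8 e9
    ext i
    fin_cases i <;> simp <;> linarith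
  have hu : IsUnit collocation3D := Matrix.mulVec_injective_iff_isUnit.mp inj
  refine ⟨(Matrix.isUnit_iff_isUnit_det _).mp hu, fun V => ?_⟩
  obtain ⟨c, hc⟩ := Matrix.mulVec_surjective_iff_isUnit.mpr hu V
  refine ⟨c, fun j => by rw [← key, hc], fun d hd => inj ?_⟩
  rw [hc]
  ext j
  rw [key]
  exact hd j
end
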